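/- If g ≥ 12, then the map 𝒟² : M^{g−1}_{(g−5)} → M^{g−3}_{(g−5)} is surjective. -/

import Mathlib

/- We model `R = ℚ[x₁, x₂, …]` as `MvPolynomial ℕ ℚ`, the variable of index `v`
representing `x_{v+1}` (so `x_k = X (k-1)` for `k ≥ 1`). -/

open MvPolynomial

noncomputable section

/-- Codimension grading: `codim x_{v+1} = v + 1`. -/
def codimW (d : ℕ →₀ ℕ) : ℕ := d.sum fun v e => (v + 1) * e

/-- Level grading: `ℓ(x_{v+1}) = v`. -/
def levelW (d : ℕ →₀ ℕ) : ℕ := d.sum fun v e => v * e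

/-- Polishchuk's operator
`𝒟 = -g ∂₁ + (1/2) ∑_{m,n ≥ 1} binom(m+n, n) x_{m+n-1} ∂_m ∂_n` (cut off beyond the
variables occurring in the argument, which loses no nonzero terms). -/
def Dop (g : ℕ) (p : MvPolynomial ℕ ℚ) : MvPolynomial ℕ ℚ :=
  -(g : ℚ) • pderiv 0 p +
    (1/2 : ℚ) •
      ∑ a ∈ Finset.range (p.vars.sup id + 1), ∑ b ∈ Finset.range (p.vars.sup id + 1),
        (((a + b + 2).choose (b + 1) : ℚ)) • (X (a + b) * pderiv a (pderiv b p))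

/-- `M^i_{(j)}`: span of monomials in `x₂, x₃, …` (no `x₁`, i.e. exponent of the
variable of index `0` is zero) of codimension `i` and level `j`. -/
def Mij (i j : ℕ) : Submodule ℚ (MvPolynomial ℕ ℚ) :=
  Submodule.span ℚ
    { p | ∃ d : ℕ →₀ ℕ, d 0 = 0 ∧ codimW d = i ∧ levelW d = j ∧ p = monomial d (1 : ℚ) }

/-- The linear relations imposed on a functional vanishing on the image of `𝒟²` have only the
trivial solution. -/
lemma eq_zero_of_merge_relations (n : ℕ) (hn : 7 ≤ n) (w : ℕ → ℚ)
    (h : ∀ a b c : ℕ, 1 ≤ a → 1 ≤ b → 1 ≤ c → a + b + c < n →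
      ((a : ℚ) + b + 2) * (n - a - b + 2) * w (a + b) +
      ((a : ℚ) + c + 2) * (n - a - c + 2) * w (a + c) +
      ((b : ℚ) + c + 2) * (n - b - c + 2) * w (b + c) +
      ((n : ℚ) - a + 2) * (n - a + 3) * w a + ((n : ℚ) - b + 2) * (n - b + 3) * w b +
      ((n : ℚ) - c + 2) * (n - c + 3) * w c +
      ((a : ℚ) + b + c + 2) * (a + b + c + 3) * w (a + b + c) = 0) :
    ∀ k, 1 ≤ k → k < n → w k = 0 := by
  have h12 : w 1 = 0 ∧ w 2 = 0 := by
    have e3 := h 1 1 1 le_rfl le_rfl le_rfl (by omega)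
    have e4 := h 1 1 2 (by simp) (by simp) (by simp) (by omega)
    have e5 := h 1 1 3 (by simp) (by simp) (by simp) (by omega)
    have e6 := h 1 1 4 (by simp) (by simp) (by simp) (by omega)
    have r5 := h 1 2 2 (by simp) (by simp) (by simp) (by omega)
    have r6 := h 1 2 3 (by simp) (by simp) (by simp) (by omega)
    have ht : (0 : ℚ) < n := by exact_mod_cast (by omega : 0 < n)
    generalize (n : ℚ) = t at *
    norm_num only [Nat.cast_one, Nat.cast_ofNat] at e3 e4 e5 e6 r5 r6
    generalize w 1 = z1 at *
    generalize w 2 = z2 at *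
    generalize w 3 = z3 at *
    generalize w 4 = z4 at *
    generalize w 5 = z5 at *
    generalize w 6 = z6 at *
    have s3 : z3 = ((-1/5) + (-3/10) * t + (-1/10) * t ^ 2) * z1 + ((-2/5) * t) * z2 := by
        linear_combination e3 / 30
    subst s3
    have s4 : z4 = ((-1/7) + (-1/6) * t + (1/42) * t ^ 3) * z1 + ((-3/14) * t + (1/14) * t ^ 2) *
        z2 := by linear_combination e4 / 42
    subst s4
    have s5 : z5 = ((-13/98) + (-297/1960) * t + (-1/560) * t ^ 2 + (27/1960) * t ^ 3 + (-13/3920)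
        * t ^ 4) * z1 + ((-8/49) * t + (17/245) * t ^ 2 + (-2/245) * t ^ 3) * z2 := by
        linear_combination e5 / 56
    subst s5
    have s6 : z6 = ((-65/504) + (-4453/30240) * t + (-29/6720) * t ^ 2 + (607/60480) * t ^ 3 +
        (-73/20160) * t ^ 4 + (19/60480) * t ^ 5) * z1 + ((-73/504) * t + (103/1680) * t ^ 2 +
        (-31/2520) * t ^ 3 + (1/1680) * t ^ 4) * z2 := by linear_combination e6 / 72
    subst s6
    have q5 : ((-12/7) + (-117/35) * t + (-21/10) * t ^ 2 + (-18/35) * t ^ 3 + (-3/70) * t ^ 4) *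
        z1 + ((-4/7) * t + (-9/35) * t ^ 2 + (-1/35) * t ^ 3) * z2 = 0 := by linear_combination r5
    have q6 : ((-25/14) + (-589/168) * t + (-1251/560) * t ^ 2 + (-949/1680) * t ^ 3 + (-29/560) *
        t ^ 4 + (-1/1680) * t ^ 5) * z1 + ((-10/7) * t + (-13/14) * t ^ 2 + (-1/5) * t ^ 3 +
        (-1/70) * t ^ 4) * z2 = 0 := by linear_combination r6
    have hd : (0 : ℚ) < 10/7 * t + 82/21 * t ^ 2 + 1181/280 * t ^ 3 + 1333/560 * t ^ 4 + 43/56 * t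
        ^ 5 + 1/7 * t ^ 6 + 1/70 * t ^ 7 + 1/1680 * t ^ 8 := by positivity
    constructor
    · refine (mul_eq_zero.mp ?_).resolve_left hd.ne'
      linear_combination ((-10/7) * t + (-13/14) * t ^ 2 + (-1/5) * t ^ 3 + (-1/70) * t ^ 4) * q5
          - ((-4/7) * t + (-9/35) * t ^ 2 + (-1/35) * t ^ 3) * q6
    · refine (mul_eq_zero.mp ?_).resolve_left hd.ne'
      linear_combination ((-12/7) + (-117/35) * t + (-21/10) * t ^ 2 + (-18/35) * t ^ 3 + (-3/70)
          * t ^ 4) * q6 - ((-25/14) + (-589/168) * t + (-1251/560) * t ^ 2 + (-949/1680) * t ^ 3 +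
          (-29/560) * t ^ 4 + (-1/1680) * t ^ 5) * q5
  intro k
  induction k using Nat.strong_induction_on with
  | _ k ih =>
    intro h1 hk
    obtain rfl | rfl | hk3 : k = 1 ∨ k = 2 ∨ 3 ≤ k := by omega
    · exact h12.1
    · exact h12.2
    · obtain ⟨c, rfl⟩ : ∃ c, k = 1 + 1 + c := ⟨k - 2, by omega⟩
      have e := h 1 1 c le_rfl le_rfl (by omega) hk
      rw [h12.1, ih (1 + 1) (by omega) (by omega) (by omega),
        ih (1 + c) (by omega) (by omega) (by omega), ih c (by omega) (by omega) (by omega)] at e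
      simp only [mul_zero, zero_add, mul_eq_zero] at e
      have hc : (0 : ℚ) ≤ c := c.cast_nonneg
      refine e.resolve_left (not_or.mpr ⟨?_, ?_⟩) <;> push_cast <;> positivity

/-- Merging with the variable of index `a`: the derivation `X b ↦ binom(a+b+2, b+1) X (a+b)`. -/
def mergeDer (a : ℕ) : Derivation ℚ (MvPolynomial ℕ ℚ) (MvPolynomial ℕ ℚ) :=
  mkDerivation ℚ fun b => ((a + b + 2).choose (b + 1) : ℚ) • X (a + b)

/-- `Dop` with an arbitrary cutoff. -/
def cutDop (g N : ℕ) (p : MvPolynomial ℕ ℚ) : MvPolynomial ℕ ℚ :=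
  -(g : ℚ) • pderiv 0 p +
    (1/2 : ℚ) • ∑ a ∈ Finset.range N, ∑ b ∈ Finset.range N,
        (((a + b + 2).choose (b + 1) : ℚ)) • (X (a + b) * pderiv a (pderiv b p))

lemma lt_of_mem_vars {N : ℕ} {p : MvPolynomial ℕ ℚ} (hN : p.vars.sup id + 1 ≤ N) {v : ℕ}
    (hv : v ∈ p.vars) : v < N :=
  (Nat.lt_succ_of_le (Finset.le_sup (f := id) hv)).trans_le hN

lemma Dop_eq_cutDop (g : ℕ) {N : ℕ} {p : MvPolynomial ℕ ℚ} (hN : p.vars.sup id + 1 ≤ N) :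
    Dop g p = cutDop g N p := by
  have hzero : ∀ b, ¬ b < p.vars.sup id + 1 → pderiv b p = 0 := fun b hb =>
    pderiv_eq_zero_of_notMem_vars fun hv : b ∈ p.vars => hb (lt_of_mem_vars le_rfl hv)
  have hcomm : ∀ a b, pderiv a (pderiv b p) = pderiv b (pderiv a p) := fun a b => by
    rw [← sub_eq_zero]
    have : ⁅(pderiv a : Derivation ℚ (MvPolynomial ℕ ℚ) (MvPolynomial ℕ ℚ)),
        (pderiv b : Derivation ℚ (MvPolynomial ℕ ℚ) (MvPolynomial ℕ ℚ))⁆ = 0 := by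
      ext i
      simp [Derivation.commutator_apply, pderiv_X, Pi.single_apply, apply_ite]
    simpa [Derivation.commutator_apply] using congrArg (fun d => d p) this
  unfold Dop cutDop
  congr 2
  refine Finset.sum_subset_zero_on_sdiff (Finset.range_mono hN) ?_ ?_
  · intro a ha
    simp only [Finset.mem_sdiff, Finset.mem_range] at ha
    refine Finset.sum_eq_zero fun b _ => ?_
    rw [hcomm, hzero a ha.2]
    simp
  · intro a _
    refine Finset.sum_subset_zero_on_sdiff (Finset.range_mono hN) ?_ fun b _ => rfl
    intro b hb
    simp only [Finset.mem_sdiff, Finset.mem_range] at hb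
    rw [hzero b hb.2]
    simp

lemma cutDop_add (g N : ℕ) (p q : MvPolynomial ℕ ℚ) :
    cutDop g N (p + q) = cutDop g N p + cutDop g N q := by
  simp only [cutDop, map_add, smul_add, mul_add, Finset.sum_add_distrib]
  abel

lemma cutDop_smul (g N : ℕ) (c : ℚ) (p : MvPolynomial ℕ ℚ) :
    cutDop g N (c • p) = c • cutDop g N p := by
  simp only [cutDop, Derivation.map_smul, smul_add, mul_smul_comm, ← Finset.smul_sum, smul_comm _ c]

/-- `Dop` as a linear map. -/
def DopLin (g : ℕ) : MvPolynomial ℕ ℚ →ₗ[ℚ] MvPolynomial ℕ ℚ where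
  toFun := Dop g
  map_add' p q := by
    let N := (p.vars.sup id + 1) ⊔ (q.vars.sup id + 1) ⊔ ((p + q).vars.sup id + 1)
    rw [Dop_eq_cutDop g (N := N) (by simp [N]), Dop_eq_cutDop g (N := N) (by simp [N]),
      Dop_eq_cutDop g (N := N) (by simp [N]), cutDop_add]
  map_smul' c p := by
    let N := (p.vars.sup id + 1) ⊔ ((c • p).vars.sup id + 1)
    rw [Dop_eq_cutDop g (N := N) (by simp [N]), Dop_eq_cutDop g (N := N) (by simp [N]),
      cutDop_smul, RingHom.id_apply]

lemma mergeDer_X (a b : ℕ) :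
    mergeDer a (X b) = ((a + b + 2).choose (b + 1) : ℚ) • X (a + b) :=
  mkDerivation_X _ _ _

lemma mergeDer_eq_sum (a : ℕ) {N : ℕ} {p : MvPolynomial ℕ ℚ} (hN : p.vars.sup id + 1 ≤ N) :
    mergeDer a p =
      ∑ b ∈ Finset.range N, ((a + b + 2).choose (b + 1) : ℚ) • (X (a + b) * pderiv b p) := by
  have hsum : ∀ (F : ℕ → Derivation ℚ (MvPolynomial ℕ ℚ) (MvPolynomial ℕ ℚ))
      (r : MvPolynomial ℕ ℚ), (∑ b ∈ Finset.range N, F b) r = ∑ b ∈ Finset.range N, F b r :=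
    fun F r => (congrFun (map_sum Derivation.coeFnAddMonoidHom F (Finset.range N)) r).trans
      (Finset.sum_apply r (Finset.range N) fun b => ⇑(F b))
  have key : mergeDer a p = (∑ b ∈ Finset.range N,
      (((a + b + 2).choose (b + 1) : ℚ) • (X (a + b) : MvPolynomial ℕ ℚ)) • pderiv b) p := by
    refine derivation_eq_of_forall_mem_vars fun i hi => ?_
    have hi' := lt_of_mem_vars hN hi
    rw [mergeDer_X, hsum, Finset.sum_eq_single i]
    · simp
    · intro b _ hb
      simp [pderiv_X_of_ne hb.symm]
    · simp [hi']
  rw [key, hsum]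
  simp

lemma Dop_X_mul (g : ℕ) {a : ℕ} (ha : 1 ≤ a) (q : MvPolynomial ℕ ℚ) :
    Dop g (X a * q) = X a * Dop g q + mergeDer a q := by
  let N := (q.vars.sup id + 1) ⊔ ((X a * q).vars.sup id + 1) ⊔ (a + 1)
  have haN : a ∈ Finset.range N := by simp [N]
  rw [Dop_eq_cutDop g (N := N) (by simp [N]), Dop_eq_cutDop g (N := N) (by simp [N]),
    mergeDer_eq_sum a (N := N) (by simp [N])]
  have h0 : pderiv 0 (X a : MvPolynomial ℕ ℚ) = 0 := pderiv_X_of_ne (by omega)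
  have hX : ∀ b, pderiv b (X a : MvPolynomial ℕ ℚ) = if b = a then 1 else 0 := fun b => by
    rw [pderiv_X, Pi.single_apply]
    simp [eq_comm]
  have h2 : ∀ b c : ℕ, pderiv b (pderiv c (X a * q)) = X a * pderiv b (pderiv c q) +
      ((if b = a then pderiv c q else 0) + if c = a then pderiv b q else 0) := fun b c => by
    simp only [Derivation.leibniz, map_add, hX, smul_eq_mul]
    split_ifs <;> simp only [map_zero, Derivation.map_one_eq_zero] <;> ring
  have hs1 : ∑ b ∈ Finset.range N, ∑ c ∈ Finset.range N, ((b + c + 2).choose (c + 1) : ℚ) •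
      (X (b + c) * if b = a then pderiv c q else 0) =
      ∑ c ∈ Finset.range N, ((a + c + 2).choose (c + 1) : ℚ) • (X (a + c) * pderiv c q) := by
    rw [Finset.sum_eq_single_of_mem a haN]
    · simp
    · intro b _ hb
      simp [hb]
  have hs2 : ∑ b ∈ Finset.range N, ∑ c ∈ Finset.range N, ((b + c + 2).choose (c + 1) : ℚ) •
      (X (b + c) * if c = a then pderiv b q else 0) =
      ∑ c ∈ Finset.range N, ((a + c + 2).choose (c + 1) : ℚ) • (X (a + c) * pderiv c q) := by
    refine Finset.sum_congr rfl fun b _ => ?_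
    rw [Finset.sum_eq_single_of_mem a haN]
    · rw [if_pos rfl, add_comm b a,
        ← Nat.choose_symm_of_eq_add (show a + b + 2 = (a + 1) + (b + 1) by omega)]
    · intro c _ hc
      simp [hc]
  simp only [cutDop, h2, mul_add, smul_add, Finset.sum_add_distrib, hs1, hs2]
  rw [Derivation.leibniz, h0]
  simp only [mul_smul_comm, Finset.mul_sum, mul_zero, add_zero, smul_eq_mul,
    mul_left_comm (X a : MvPolynomial ℕ ℚ)]
  module

lemma Dop_one (g : ℕ) : Dop g 1 = 0 := by
  simp [Dop]

lemma Dop_X (g : ℕ) {a : ℕ} (ha : 1 ≤ a) : Dop g (X a) = 0 := by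
  rw [← mul_one (X a), Dop_X_mul g ha, Dop_one]
  simp

/-- The variable of index `a` rescaled by `(a+1)!`. -/
def normX (a : ℕ) : MvPolynomial ℕ ℚ := ((a + 1).factorial : ℚ) • X a

/-- The derivation attached to `normX a`. -/
def normMerge (a : ℕ) : Derivation ℚ (MvPolynomial ℕ ℚ) (MvPolynomial ℕ ℚ) :=
  ((a + 1).factorial : ℚ) • mergeDer a

lemma normMerge_normX (a b : ℕ) :
    normMerge a (normX b) = ((a : ℚ) + b + 2) • normX (a + b) := by
  have h := Nat.add_choose_mul_factorial_mul_factorial (a + 1) (b + 1)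
  rw [show a + 1 + (b + 1) = a + b + 2 by ring,
    Nat.factorial_succ (a + b + 1)] at h
  have h' := congrArg (Nat.cast (R := ℚ)) h
  push_cast at h'
  simp only [normMerge, normX, Derivation.smul_apply, Derivation.map_smul, mergeDer_X, smul_smul]
  congr 1
  linear_combination h'

lemma DopLin_normX_mul (g : ℕ) {a : ℕ} (ha : 1 ≤ a) (q : MvPolynomial ℕ ℚ) :
    DopLin g (normX a * q) = normX a * DopLin g q + normMerge a q := by
  rw [normX, smul_mul_assoc, map_smul]
  change (_ : ℚ) • Dop g (X a * q) = _ * Dop g q + (_ : ℚ) • mergeDer a q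
  rw [Dop_X_mul g ha, smul_add, smul_mul_assoc]

lemma DopLin_normX (g : ℕ) {a : ℕ} (ha : 1 ≤ a) : DopLin g (normX a) = 0 := by
  rw [normX, map_smul]
  change (_ : ℚ) • Dop g (X a) = 0
  rw [Dop_X g ha, smul_zero]

lemma DopLin_triple (g : ℕ) {a b c : ℕ} (ha : 1 ≤ a) (hb : 1 ≤ b) (hc : 1 ≤ c) :
    DopLin g (normX a * (normX b * normX c)) =
      ((a : ℚ) + b + 2) • (normX (a + b) * normX c) +
      ((a : ℚ) + c + 2) • (normX (a + c) * normX b) +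
      ((b : ℚ) + c + 2) • (normX (b + c) * normX a) := by
  simp only [DopLin_normX_mul g ha, DopLin_normX_mul g hb, DopLin_normX g hc,
    Derivation.leibniz, normMerge_normX, smul_eq_mul, mul_zero, zero_add, smul_eq_C_mul]
  ring

lemma DopLin_quadruple (g : ℕ) {a b c d : ℕ} (ha : 1 ≤ a) (hb : 1 ≤ b) (hc : 1 ≤ c)
    (hd : 1 ≤ d) :
    DopLin g (normX a * (normX b * (normX c * normX d))) =
      ((a : ℚ) + b + 2) • (normX (a + b) * (normX c * normX d)) +
      ((a : ℚ) + c + 2) • (normX (a + c) * (normX b * normX d)) +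
      ((a : ℚ) + d + 2) • (normX (a + d) * (normX b * normX c)) +
      ((b : ℚ) + c + 2) • (normX (b + c) * (normX a * normX d)) +
      ((b : ℚ) + d + 2) • (normX (b + d) * (normX a * normX c)) +
      ((c : ℚ) + d + 2) • (normX (c + d) * (normX a * normX b)) := by
  rw [DopLin_normX_mul g ha, DopLin_triple g hb hc hd]
  simp only [Derivation.leibniz, normMerge_normX, smul_eq_mul, smul_eq_C_mul]
  ring

lemma DopLin_DopLin_quadruple (g : ℕ) {a b c d : ℕ} (ha : 1 ≤ a) (hb : 1 ≤ b) (hc : 1 ≤ c)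
    (hd : 1 ≤ d) :
    DopLin g (DopLin g (normX a * (normX b * (normX c * normX d)))) =
      (2 : ℚ) •
      ((((a : ℚ) + b + 2) * (c + d + 2)) • (normX (a + b) * normX (c + d)) +
      (((a : ℚ) + c + 2) * (b + d + 2)) • (normX (a + c) * normX (b + d)) +
      (((b : ℚ) + c + 2) * (a + d + 2)) • (normX (b + c) * normX (a + d)) +
      (((b : ℚ) + c + d + 2) * (b + c + d + 3)) • (normX a * normX (b + c + d)) +
      (((a : ℚ) + c + d + 2) * (a + c + d + 3)) • (normX b * normX (a + c + d)) +
      (((a : ℚ) + b + d + 2) * (a + b + d + 3)) • (normX c * normX (a + b + d)) +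
      (((a : ℚ) + b + c + 2) * (a + b + c + 3)) • (normX (a + b + c) * normX d)) := by
  have t : ∀ {p q : ℕ}, 1 ≤ p → 1 ≤ p + q := fun h => le_add_right h
  rw [DopLin_quadruple g ha hb hc hd]
  simp only [map_add, map_smul, DopLin_triple g (t ha) hb hc, DopLin_triple g (t ha) hb hd,
    DopLin_triple g (t ha) hc hd, DopLin_triple g (t hb) ha hc, DopLin_triple g (t hb) ha hd,
    DopLin_triple g (t hc) ha hb, Nat.cast_add, show a + c + b = a + b + c by ring,
    show a + d + b = a + b + d by ring, show a + d + c = a + c + d by ring,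
    show b + c + a = a + b + c by ring, show b + d + a = a + b + d by ring,
    show b + d + c = b + c + d by ring, show c + d + a = a + c + d by ring,
    show c + d + b = b + c + d by ring]
  simp only [smul_eq_C_mul, C_add, C_mul, map_ofNat]
  ring

lemma codimW_add (d e : ℕ →₀ ℕ) : codimW (d + e) = codimW d + codimW e :=
  Finsupp.sum_add_index' (by simp) (by intros; ring)

lemma levelW_add (d e : ℕ →₀ ℕ) : levelW (d + e) = levelW d + levelW e :=
  Finsupp.sum_add_index' (by simp) (by intros; ring)

lemma codimW_single (a : ℕ) : codimW (Finsupp.single a 1) = a + 1 := by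
  simp [codimW, Finsupp.sum_single_index]

lemma levelW_single (a : ℕ) : levelW (Finsupp.single a 1) = a := by
  simp [levelW, Finsupp.sum_single_index]

lemma one_mem_Mij : (1 : MvPolynomial ℕ ℚ) ∈ Mij 0 0 :=
  Submodule.subset_span ⟨0, by simp [codimW, levelW]⟩

lemma X_mul_mem_Mij {a i j : ℕ} (ha : 1 ≤ a) {p : MvPolynomial ℕ ℚ} (hp : p ∈ Mij i j) :
    X a * p ∈ Mij (i + a + 1) (j + a) := by
  induction hp using Submodule.span_induction with
  | mem q hq =>
    obtain ⟨d, h0, rfl, rfl, rfl⟩ := hq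
    refine Submodule.subset_span ⟨d + Finsupp.single a 1, ?_, ?_, ?_, ?_⟩
    · simp [h0, Finsupp.single_apply]
      omega
    · rw [codimW_add, codimW_single, add_assoc]
    · rw [levelW_add, levelW_single]
    · rw [X, monomial_mul, add_comm, one_mul]
  | zero => simp
  | add p q _ _ hp hq =>
    rw [mul_add]
    exact add_mem hp hq
  | smul c p _ hp =>
    rw [mul_smul_comm]
    exact Submodule.smul_mem _ c hp

lemma normX_mul_mem_Mij {a i j : ℕ} (ha : 1 ≤ a) {p : MvPolynomial ℕ ℚ} (hp : p ∈ Mij i j) :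
    normX a * p ∈ Mij (i + a + 1) (j + a) := by
  rw [normX, smul_mul_assoc]
  exact Submodule.smul_mem _ _ (X_mul_mem_Mij ha hp)

lemma codimW_eq_levelW_add_card (d : ℕ →₀ ℕ) :
    codimW d = levelW d + Multiset.card (Finsupp.toMultiset d) := by
  rw [Finsupp.card_toMultiset, codimW, levelW, ← Finsupp.sum_add]
  exact Finsupp.sum_congr fun v _ => by simp; ring

/-- The generators of `Mij (n + 2) n` are products of two variables. -/
lemma exists_eq_single_add_single {n : ℕ} {d : ℕ →₀ ℕ} (h0 : d 0 = 0) (hc : codimW d = n + 2)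
    (hl : levelW d = n) :
    ∃ a b, 1 ≤ a ∧ 1 ≤ b ∧ a + b = n ∧ d = Finsupp.single a 1 + Finsupp.single b 1 := by
  have hcard : Multiset.card (Finsupp.toMultiset d) = 2 := by
    have := codimW_eq_levelW_add_card d
    omega
  obtain ⟨a, b, hab⟩ := Multiset.card_eq_two.mp hcard
  have hd : d = Finsupp.single a 1 + Finsupp.single b 1 := by
    apply Multiset.toFinsupp.symm.injective
    change Finsupp.toMultiset d = Finsupp.toMultiset _
    rw [hab, map_add, Finsupp.toMultiset_single, Finsupp.toMultiset_single]
    rfl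
  subst hd
  rw [levelW_add, levelW_single, levelW_single] at hl
  simp only [Finsupp.add_apply, Finsupp.single_apply] at h0
  refine ⟨a, b, ?_, ?_, hl, rfl⟩
  · rcases Nat.eq_zero_or_pos a with rfl | ha
    · simp at h0
    · exact ha
  · rcases Nat.eq_zero_or_pos b with rfl | hb
    · simp at h0
    · exact hb

theorem Mij_le_map_DopLin_DopLin (g : ℕ) {n : ℕ} (hn : 7 ≤ n) :
    Mij (n + 2) n ≤ (Mij (n + 4) n).map (DopLin g ∘ₗ DopLin g) := by
  refine Submodule.span_le.mpr ?_
  rintro _ ⟨d, h0, hcodim, hlevel, rfl⟩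
  obtain ⟨p, q, hp, hq, hpq, rfl⟩ := exists_eq_single_add_single h0 hcodim hlevel
  by_contra hmem
  obtain ⟨φ, hφ, hker⟩ := Submodule.exists_le_ker_of_notMem hmem
  have hw := eq_zero_of_merge_relations n hn (fun k => φ (normX k * normX (n - k))) (by
    intro a b c ha hb hc habc
    obtain ⟨d, rfl⟩ : ∃ d, n = a + b + c + d := ⟨n - (a + b + c), by omega⟩
    have hd : 1 ≤ d := by omega
    have hquad : normX a * (normX b * (normX c * normX d)) ∈
        Mij (a + b + c + d + 4) (a + b + c + d) := by
      have h := normX_mul_mem_Mij ha (normX_mul_mem_Mij hb (normX_mul_mem_Mij hc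
        (normX_mul_mem_Mij hd one_mem_Mij)))
      rwa [mul_one, show 0 + d + 1 + c + 1 + b + 1 + a + 1 = a + b + c + d + 4 by ring,
        show 0 + d + c + b + a = a + b + c + d by ring] at h
    have h := LinearMap.mem_ker.mp (hker (Submodule.mem_map_of_mem hquad))
    rw [LinearMap.comp_apply, DopLin_DopLin_quadruple g ha hb hc hd] at h
    simp only [map_add, map_smul, smul_eq_mul] at h
    simp only [show a + b + c + d - (a + b) = c + d by omega,
      show a + b + c + d - (a + c) = b + d by omega,
      show a + b + c + d - (b + c) = a + d by omega,
      show a + b + c + d - a = b + c + d by omega,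
      show a + b + c + d - b = a + c + d by omega,
      show a + b + c + d - c = a + b + d by omega,
      show a + b + c + d - (a + b + c) = d by omega]
    push_cast
    linear_combination h / 2) p hp (by omega)
  apply hφ
  rw [show n - p = q by omega] at hw
  simp only [normX, smul_mul_assoc, mul_smul_comm, map_smul, smul_eq_mul, mul_eq_zero,
    Nat.cast_eq_zero, Nat.factorial_ne_zero, false_or] at hw
  rwa [X, X, monomial_mul, one_mul] at hw

/-- if `g ≥ 12` then `𝒟² : M^{g−1}_{(g−5)} → M^{g−3}_{(g−5)}` is
surjective. -/
theorem stmt9 (g : ℕ) (hg : 12 ≤ g) :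
    ∀ y ∈ Mij (g - 3) (g - 5), ∃ x ∈ Mij (g - 1) (g - 5), Dop g (Dop g x) = y := by
  obtain ⟨n, rfl⟩ : ∃ n, g = n + 5 := ⟨g - 5, by omega⟩
  intro y hy
  obtain ⟨x, hx, rfl⟩ := Mij_le_map_DopLin_DopLin (n + 5) (n := n) (by omega) hy
  exact ⟨x, hx, rfl⟩
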